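/- arXiv:2404.05026 — 3 statements merged into one kernel-verified Lean document; each statement's English description precedes it below -/
import Mathlib

section
/- Fix an integer k ≥ 3 and a real γ ∈ (0,1). There exist c > 0 and N such that for all n ≥ N, the number of H ∈ B_n that are not γ-equitable (i.e., that admit some bipartition [n] = X ∪ Y with min(|X|,|Y|) < (1−γ)n/2) is at most |B_n| · 2^{−c·n^k}. -/
open Finset

/-- `H` is a `k`-graph on `[n]`: every edge is a `k`-element subset. -/
def IsKGraph (n k : ℕ) (H : Finset (Finset (Fin n))) : Prop :=
  ∀ e ∈ H, e.card = k

/-- `X, Y` is a bipartition of the hypergraph `H` on `[n]`. -/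
def IsBipartition (n : ℕ) (H : Finset (Finset (Fin n))) (X Y : Finset (Fin n)) : Prop :=
  Disjoint X Y ∧ X ∪ Y = Finset.univ ∧ ∀ e ∈ H, ¬ e ⊆ X ∧ ¬ e ⊆ Y

/-- `B_n`: the collection of all bipartite `k`-graphs on `[n]`. -/
def Bip (n k : ℕ) : Set (Finset (Finset (Fin n))) :=
  {H | IsKGraph n k H ∧ ∃ X Y : Finset (Fin n), IsBipartition n H X Y}

/-- `K[X,Y]`: the crossing `k`-sets, i.e. those contained neither in `X` nor in `Y`. -/
def crossing (n k : ℕ) (X Y : Finset (Fin n)) : Finset (Finset (Fin n)) :=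
  (Finset.univ.powersetCard k).filter fun e => ¬ e ⊆ X ∧ ¬ e ⊆ Y

/-- joint `H`-degree of `u` and `v`: the number of `(k-1)`-sets `J ⊆ [n] \ {u,v}`
with `{u} ∪ J ∈ H` and `{v} ∪ J ∈ H`. -/
def jointDeg (n k : ℕ) (H : Finset (Finset (Fin n))) (u v : Fin n) : ℕ :=
  (((Finset.univ \ {u, v}).powersetCard (k - 1)).filter
    fun J => insert u J ∈ H ∧ insert v J ∈ H).card

/-- `deg_H(v, U)`: the number of `(k-1)`-sets `J ⊆ U \ {v}` with `{v} ∪ J ∈ H`. -/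
def degIn (n k : ℕ) (H : Finset (Finset (Fin n))) (v : Fin n) (U : Finset (Fin n)) : ℕ :=
  (((U \ {v}).powersetCard (k - 1)).filter fun J => insert v J ∈ H).card

/-- `e_{H_J}(A, B)`: for disjoint `A`, `B`, the number of link-graph edges of `H_J`
with one endpoint in `A` and one in `B`. -/
def linkBetween (n : ℕ) (H : Finset (Finset (Fin n))) (J A B : Finset (Fin n)) : ℕ :=
  ((A ×ˢ B).filter fun p => p.1 ∉ J ∧ p.2 ∉ J ∧ insert p.1 (insert p.2 J) ∈ H).card

/-- `e_{H_J}(A)`: the number of link-graph edges of `H_J` contained in `A`. -/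
def linkWithin (n : ℕ) (H : Finset (Finset (Fin n))) (J A : Finset (Fin n)) : ℕ :=
  ((A.powersetCard 2).filter fun p => Disjoint p J ∧ p ∪ J ∈ H).card

theorem choose_add_choose_le (k w p q : ℕ) :
    (w + p).choose k + (w + q).choose k ≤ (w + p + q).choose k + w.choose k := by
  cases k with
  | zero => simp
  | succ k =>
    induction p with
    | zero => simp [add_comm]
    | succ p ih =>
      have h1 : (w + (p + 1)).choose (k + 1) = (w + p).choose k + (w + p).choose (k + 1) := by
        rw [← add_assoc, Nat.choose_succ_succ]
      have h2 : (w + (p + 1) + q).choose (k + 1)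
          = (w + p + q).choose k + (w + p + q).choose (k + 1) := by
        rw [show w + (p + 1) + q = w + p + q + 1 by ring, Nat.choose_succ_succ]
      have h3 : (w + p).choose k ≤ (w + p + q).choose k := Nat.choose_le_choose k (by omega)
      omega

theorem choose_add_choose_add_choose_le (k w p q : ℕ) (hk : k ≠ 0) :
    (w + p).choose k + (w + q).choose k + (p + q).choose k
      ≤ (w + p + q).choose k + p.choose k + q.choose k + w.choose k := by
  obtain ⟨k, rfl⟩ := Nat.exists_eq_succ_of_ne_zero hk
  induction w with
  | zero => simp; omega
  | succ w ih =>
    have h1 : (w + 1 + p).choose (k + 1) = (w + p).choose k + (w + p).choose (k + 1) := by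
      rw [show w + 1 + p = w + p + 1 by ring, Nat.choose_succ_succ]
    have h2 : (w + 1 + q).choose (k + 1) = (w + q).choose k + (w + q).choose (k + 1) := by
      rw [show w + 1 + q = w + q + 1 by ring, Nat.choose_succ_succ]
    have h3 : (w + 1 + p + q).choose (k + 1)
        = (w + p + q).choose k + (w + p + q).choose (k + 1) := by
      rw [show w + 1 + p + q = w + p + q + 1 by ring, Nat.choose_succ_succ]
    have h4 : (w + 1).choose (k + 1) = w.choose k + w.choose (k + 1) := Nat.choose_succ_succ _ _
    have h5 := choose_add_choose_le k w p q
    simp only [Nat.succ_eq_add_one] at ih ⊢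
    omega

theorem choose_succ_add_mul_choose_le (k d j : ℕ) :
    d.choose (k + 1) + j * d.choose k ≤ (d + j).choose (k + 1) := by
  induction j with
  | zero => simp
  | succ j ih =>
    have h1 : (d + (j + 1)).choose (k + 1) = (d + j).choose k + (d + j).choose (k + 1) := by
      rw [← add_assoc, Nat.choose_succ_succ]
    have h2 : d.choose k ≤ (d + j).choose k := Nat.choose_le_choose k (by omega)
    rw [add_mul]
    omega

theorem three_mul_choose_le (k d : ℕ) (hk : 2 ≤ k) :
    3 * d.choose k ≤ (d + d).choose k := by
  obtain ⟨k, rfl⟩ : ∃ j, k = j + 1 := ⟨k - 1, by omega⟩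
  have h1 := choose_succ_add_mul_choose_le k d d
  have h2 : d.choose (k + 1) * 2 ≤ d * d.choose k :=
    calc d.choose (k + 1) * 2 ≤ d.choose (k + 1) * (k + 1) := Nat.mul_le_mul_left _ hk
      _ = d.choose k * (d - k) := Nat.choose_succ_right_eq d k
      _ ≤ d.choose k * d := Nat.mul_le_mul_left _ (Nat.sub_le _ _)
      _ = d * d.choose k := mul_comm _ _
  omega

/-- Shifting `d` elements from the smaller to the larger part increases the number of
monochromatic `k`-sets by at least `d.choose k`. -/
theorem choose_gap (k a d e : ℕ) (hk : 2 ≤ k) :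
    (a + d).choose k + (a + d + e).choose k + d.choose k
      ≤ a.choose k + (a + d + d + e).choose k := by
  have h1 := choose_add_choose_add_choose_le k a d (d + e) (by omega)
  have h2 := choose_add_choose_le k d d e
  have h3 := three_mul_choose_le k d hk
  simp only [← add_assoc] at h1
  omega

theorem card_crossing_add {n k : ℕ} {X Y : Finset (Fin n)} (hk : k ≠ 0) (hd : Disjoint X Y) :
    (crossing n k X Y).card + (X.card.choose k + Y.card.choose k) = n.choose k := by
  classical
  have hsplit := Finset.card_filter_add_card_filter_not
    (s := (Finset.univ : Finset (Fin n)).powersetCard k) (fun e => ¬ e ⊆ X ∧ ¬ e ⊆ Y)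
  have hmono : ((Finset.univ : Finset (Fin n)).powersetCard k).filter
      (fun e => ¬ (¬ e ⊆ X ∧ ¬ e ⊆ Y)) = X.powersetCard k ∪ Y.powersetCard k := by
    ext e
    simp only [mem_filter, mem_powersetCard, mem_union, subset_univ, true_and]
    tauto
  have hdisj : Disjoint (X.powersetCard k) (Y.powersetCard k) := by
    rw [Finset.disjoint_left]
    intro e h1 h2
    rw [mem_powersetCard] at h1 h2
    have : e = ∅ := by
      simpa using hd h1.1 h2.1
    subst this
    exact hk (by simpa using h1.2.symm)
  rw [hmono, card_union_of_disjoint hdisj] at hsplit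
  simpa [crossing] using hsplit

theorem card_eq_of_isBipartition {n : ℕ} {H : Finset (Finset (Fin n))} {X Y : Finset (Fin n)}
    (h : IsBipartition n H X Y) : X.card + Y.card = n := by
  rw [← card_union_of_disjoint h.1, h.2.1, card_fin]

theorem subset_crossing {n k : ℕ} {H : Finset (Finset (Fin n))} {X Y : Finset (Fin n)}
    (hH : IsKGraph n k H) (h : IsBipartition n H X Y) : H ⊆ crossing n k X Y := by
  intro e he
  simp only [crossing, mem_filter, mem_powersetCard, subset_univ, true_and]
  exact ⟨hH e he, h.2.2 e he⟩

theorem two_pow_card_crossing_le {n k : ℕ} {X Y : Finset (Fin n)} (hd : Disjoint X Y)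
    (hu : X ∪ Y = Finset.univ) : 2 ^ (crossing n k X Y).card ≤ (Bip n k).ncard := by
  rw [← card_powerset, ← Set.ncard_coe_finset]
  refine Set.ncard_le_ncard ?_ (Set.toFinite _)
  intro H hH
  rw [mem_coe, mem_powerset] at hH
  have hmem : ∀ e ∈ H, e.card = k ∧ ¬ e ⊆ X ∧ ¬ e ⊆ Y := fun e he => by
    simpa [crossing] using hH he
  exact ⟨fun e he => (hmem e he).1, X, Y, hd, hu, fun e he => (hmem e he).2⟩

theorem ncard_le_of_card_crossing_le {n k : ℕ} {M : ℝ}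
    (P : Finset (Fin n) → Finset (Fin n) → Prop)
    (hM : ∀ X Y, Disjoint X Y → X ∪ Y = Finset.univ → P X Y →
      ((crossing n k X Y).card : ℝ) ≤ M) :
    ({H ∈ Bip n k | ∃ X Y : Finset (Fin n), IsBipartition n H X Y ∧ P X Y}.ncard : ℝ)
      ≤ (2 : ℝ) ^ n * (2 : ℝ) ^ M := by
  classical
  let S : Finset (Finset (Fin n)) := Finset.univ.filter fun X => P X Xᶜ
  have hsub : {H ∈ Bip n k | ∃ X Y : Finset (Fin n), IsBipartition n H X Y ∧ P X Y}
      ⊆ (S.biUnion fun X => (crossing n k X Xᶜ).powerset : Finset _) := by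
    rintro H ⟨⟨hH, -⟩, X, Y, hXY, hP⟩
    have hY : Y = Xᶜ := (IsCompl.compl_eq ⟨hXY.1, codisjoint_iff.2 hXY.2.1⟩).symm
    subst hY
    rw [mem_coe, mem_biUnion]
    exact ⟨X, by simpa [S] using hP, mem_powerset.2 (subset_crossing hH hXY)⟩
  have hcard : {H ∈ Bip n k | ∃ X Y : Finset (Fin n), IsBipartition n H X Y ∧ P X Y}.ncard
      ≤ ∑ X ∈ S, 2 ^ (crossing n k X Xᶜ).card := by
    refine (Set.ncard_le_ncard hsub (Set.toFinite _)).trans ?_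
    rw [Set.ncard_coe_finset]
    simpa only [card_powerset] using
      card_biUnion_le (s := S) (t := fun X => (crossing n k X Xᶜ).powerset)
  calc _ ≤ ((∑ X ∈ S, 2 ^ (crossing n k X Xᶜ).card : ℕ) : ℝ) := by exact_mod_cast hcard
    _ ≤ ∑ _X ∈ S, (2 : ℝ) ^ M := by
        push_cast
        refine Finset.sum_le_sum fun X hX => ?_
        rw [← Real.rpow_natCast]
        exact Real.rpow_le_rpow_of_exponent_le one_le_two
          (hM X Xᶜ disjoint_compl_right (union_compl X) (by simpa [S] using hX))
    _ ≤ (2 : ℝ) ^ n * (2 : ℝ) ^ M := by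
        rw [sum_const, nsmul_eq_mul]
        gcongr
        exact_mod_cast (card_le_univ S).trans_eq (by simp)

theorem card_crossing_add_choose_le {n k d a : ℕ} {X Y U V : Finset (Fin n)} (hk : 2 ≤ k)
    (hXY : Disjoint X Y) (hXYu : X ∪ Y = Finset.univ) (hUV : Disjoint U V)
    (hUVu : U ∪ V = Finset.univ) (hU : U.card = n / 2) (ha : min X.card Y.card = a)
    (hd : a + d = n / 2) :
    (crossing n k X Y).card + d.choose k ≤ (crossing n k U V).card := by
  have h1 := card_crossing_add (k := k) (by omega) hXY
  have h2 := card_crossing_add (k := k) (by omega) hUV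
  have h3 : X.card + Y.card = n := by rw [← card_union_of_disjoint hXY, hXYu, card_fin]
  have h4 : U.card + V.card = n := by rw [← card_union_of_disjoint hUV, hUVu, card_fin]
  have h5 := choose_gap k a d (n % 2) hk
  rw [show a + d = U.card by omega, show U.card + n % 2 = V.card by omega] at h5
  rcases le_total X.card Y.card with h | h
  · rw [min_eq_left h] at ha
    rw [show a = X.card by omega, show U.card + d + n % 2 = Y.card by omega] at h5
    omega
  · rw [min_eq_right h] at ha
    rw [show a = Y.card by omega, show U.card + d + n % 2 = X.card by omega] at h5
    omega

theorem stmt3 (k : ℕ) (hk : 3 ≤ k) (γ : ℝ) (hγ0 : 0 < γ) (hγ1 : γ < 1) :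
    ∃ c : ℝ, 0 < c ∧ ∃ N : ℕ, ∀ n : ℕ, N ≤ n →
      (({H ∈ Bip n k | ∃ X Y : Finset (Fin n), IsBipartition n H X Y ∧
          (min X.card Y.card : ℝ) < (1 - γ) * n / 2}.ncard : ℝ))
        ≤ ((Bip n k).ncard : ℝ) * (2 : ℝ) ^ (-(c * (n : ℝ) ^ k)) := by
  set b : ℝ := (γ / 4) ^ k / k.factorial with hb
  have hb0 : 0 < b := by positivity
  refine ⟨b / 2, by positivity, ⌈4 * (k + 1) / γ⌉₊ + ⌈2 / b⌉₊ + 1, fun n hn => ?_⟩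
  have hnR : (⌈4 * (k + 1) / γ⌉₊ : ℝ) + ⌈2 / b⌉₊ + 1 ≤ n := by exact_mod_cast hn
  have hn1 : (1 : ℝ) ≤ n := by
    have : (0 : ℝ) ≤ (⌈4 * (k + 1) / γ⌉₊ : ℝ) + ⌈2 / b⌉₊ := by positivity
    linarith
  have hnγ : 4 * ((k : ℝ) + 1) ≤ γ * n := by
    have h1 := Nat.le_ceil (4 * ((k : ℝ) + 1) / γ)
    have h2 : 4 * ((k : ℝ) + 1) / γ ≤ n := by
      have : (0 : ℝ) ≤ (⌈2 / b⌉₊ : ℝ) := by positivity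
      linarith
    rw [div_le_iff₀ hγ0] at h2
    linarith
  have hnb : 2 ≤ b * n := by
    have h1 := Nat.le_ceil (2 / b)
    have h2 : 2 / b ≤ n := by
      have : (0 : ℝ) ≤ (⌈4 * ((k : ℝ) + 1) / γ⌉₊ : ℝ) := by positivity
      linarith
    rw [div_le_iff₀ hb0] at h2
    linarith
  obtain ⟨U, -, hU⟩ := Finset.exists_subset_card_eq
    (s := (Finset.univ : Finset (Fin n))) (n := n / 2) (by simp; omega)
  have hdrop : ∀ X Y : Finset (Fin n), Disjoint X Y → X ∪ Y = Finset.univ →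
      (min X.card Y.card : ℝ) < (1 - γ) * n / 2 →
      ((crossing n k X Y).card : ℝ) + b * n ^ k ≤ (crossing n k U Uᶜ).card := by
    intro X Y hXY hXYu hmin
    obtain ⟨a, ha⟩ : ∃ a, min X.card Y.card = a := ⟨_, rfl⟩
    have haR : (a : ℝ) < (1 - γ) * n / 2 := by rw [← ha]; push_cast; exact hmin
    have hhalf : (n : ℝ) ≤ 2 * (n / 2 : ℕ) + 1 := by
      exact_mod_cast (by omega : n ≤ 2 * (n / 2) + 1)
    have hgap : (a : ℝ) + γ * n / 4 + k ≤ (n / 2 : ℕ) := by linarith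
    have hle : a + k ≤ n / 2 := by
      have : (a : ℝ) + k ≤ (n / 2 : ℕ) := by
        have : 0 ≤ γ * n / 4 := by positivity
        linarith
      exact_mod_cast this
    obtain ⟨d, hd⟩ := Nat.exists_eq_add_of_le (show a ≤ n / 2 by omega)
    have hcross := card_crossing_add_choose_le (k := k) (by omega) hXY hXYu
      (disjoint_compl_right (a := U)) (union_compl U) hU ha hd.symm
    have hcrossR : ((crossing n k X Y).card : ℝ) + d.choose k ≤ (crossing n k U Uᶜ).card := by
      exact_mod_cast hcross
    have hchoose : b * (n : ℝ) ^ k ≤ d.choose k := by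
      refine le_trans ?_ (Nat.pow_le_choose (α := ℝ) k d)
      rw [hb, div_mul_eq_mul_div, ← mul_pow]
      have hbase : γ / 4 * n ≤ ((d + 1 - k : ℕ) : ℝ) := by
        rw [Nat.cast_sub (by omega)]
        rw [hd] at hgap
        push_cast at hgap ⊢
        linarith
      gcongr
    linarith
  have hnk : (n : ℝ) ≤ b / 2 * n ^ k := by
    have h1 : (n : ℝ) ^ 2 ≤ (n : ℝ) ^ k := pow_le_pow_right₀ hn1 (by omega)
    nlinarith
  set C := (crossing n k U Uᶜ).card with hC
  have hupper := ncard_le_of_card_crossing_le (k := k) (M := (C : ℝ) - b * n ^ k)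
    (fun X Y : Finset (Fin n) => (min X.card Y.card : ℝ) < (1 - γ) * n / 2)
    fun X Y h1 h2 h3 => by linarith [hdrop X Y h1 h2 h3]
  have hlower : (2 : ℝ) ^ C ≤ (Bip n k).ncard := by
    exact_mod_cast two_pow_card_crossing_le (k := k) (disjoint_compl_right (a := U)) (union_compl U)
  calc _ ≤ (2 : ℝ) ^ n * (2 : ℝ) ^ ((C : ℝ) - b * n ^ k) := hupper
    _ = (2 : ℝ) ^ ((n : ℝ) + ((C : ℝ) - b * n ^ k)) := by
        rw [Real.rpow_add two_pos, Real.rpow_natCast]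
    _ ≤ (2 : ℝ) ^ ((C : ℝ) + -(b / 2 * n ^ k)) :=
        Real.rpow_le_rpow_of_exponent_le one_le_two (by linarith)
    _ = (2 : ℝ) ^ C * (2 : ℝ) ^ (-(b / 2 * (n : ℝ) ^ k)) := by
        rw [Real.rpow_add two_pos, Real.rpow_natCast]
    _ ≤ _ := by gcongr
end

section
/- Fix an integer k ≥ 3 and a real σ with 0 < σ < 2^{−k}. There exist γ ∈ (0,1), c > 0 and N such that for every n ≥ N and every partition [n] = X ∪ Y with |X|, |Y| ≥ (1−γ)n/2, the number of k-graphs H on [n] with E_H ⊆ K[X,Y] for which the bipartition X ∪ Y is NOT σ-standard w.r.t. H is at most 2^{|K[X,Y]|} · 2^{−c·n^{k−1}}. -/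
open Finset

/-- The bipartition `X, Y` is `σ`-standard w.r.t. `H`. -/
def SigmaStandardWrt (n k : ℕ) (σ : ℝ) (H : Finset (Finset (Fin n)))
    (X Y : Finset (Fin n)) : Prop :=
  ∀ u v : Fin n, u ≠ v →
    (((u ∈ X ∧ v ∈ X) ∨ (u ∈ Y ∧ v ∈ Y)) →
      |(jointDeg n k H u v : ℝ) -
          (1 / 4 : ℝ) * (n.choose (k - 1) : ℝ) * (1 - (2 : ℝ) ^ (1 - (k : ℤ)))|
        ≤ σ * ((1 / 4 : ℝ) * (n.choose (k - 1) : ℝ))) ∧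
    (¬ ((u ∈ X ∧ v ∈ X) ∨ (u ∈ Y ∧ v ∈ Y)) →
      |(jointDeg n k H u v : ℝ) -
          (1 / 4 : ℝ) * (n.choose (k - 1) : ℝ) * (1 - (2 : ℝ) ^ (2 - (k : ℤ)))|
        ≤ σ * ((1 / 4 : ℝ) * (n.choose (k - 1) : ℝ)))

/-- `H` is `σ`-standard: every bipartition of `H` is `σ`-standard w.r.t. `H`. -/
def SigmaStandard (n k : ℕ) (σ : ℝ) (H : Finset (Finset (Fin n))) : Prop :=
  ∀ X Y : Finset (Fin n), IsBipartition n H X Y → SigmaStandardWrt n k σ H X Y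

theorem sum_powerset_pow_card_filter_pair {ι α : Type*} [DecidableEq ι] [DecidableEq α]
    (f g : ι → α) (x : ℝ) (S : Finset ι) (K : Finset α) (hK : ∀ j ∈ S, f j ∈ K ∧ g j ∈ K)
    (hf : Set.InjOn f S) (hg : Set.InjOn g S) (hfg : ∀ i ∈ S, ∀ j ∈ S, f i ≠ g j) :
    ∑ H ∈ K.powerset, x ^ #{j ∈ S | f j ∈ H ∧ g j ∈ H} = 2 ^ #K * ((3 + x) / 4) ^ #S := by
  induction S using Finset.induction_on generalizing K with
  | empty => simp
  | insert j S hj ih =>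
    obtain ⟨hfK, hgK⟩ := hK j (mem_insert_self j S)
    have hne : f j ≠ g j := hfg j (mem_insert_self j S) j (mem_insert_self j S)
    have hf' : ∀ i ∈ S, f i ≠ f j := fun i hi h =>
      hj (hf (mem_insert_of_mem hi) (mem_insert_self j S) h ▸ hi)
    have hg' : ∀ i ∈ S, g i ≠ g j := fun i hi h =>
      hj (hg (mem_insert_of_mem hi) (mem_insert_self j S) h ▸ hi)
    have hfg' : ∀ i ∈ S, f i ≠ g j := fun i hi =>
      hfg i (mem_insert_of_mem hi) j (mem_insert_self j S)
    have hgf' : ∀ i ∈ S, g i ≠ f j := fun i hi h =>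
      hfg j (mem_insert_self j S) i (mem_insert_of_mem hi) h.symm
    obtain ⟨K', hgK', hfK', rfl⟩ : ∃ K' : Finset α, g j ∉ K' ∧ f j ∉ insert (g j) K' ∧
        K = insert (f j) (insert (g j) K') := by
      refine ⟨(K.erase (f j)).erase (g j), by simp, by simp [hne], ?_⟩
      rw [insert_erase (mem_erase.2 ⟨hne.symm, hgK⟩), insert_erase hfK]
    have hS : ∀ i ∈ S, f i ∈ K' ∧ g i ∈ K' := by
      intro i hi
      have := hK i (mem_insert_of_mem hi)
      simpa [hf' i hi, hg' i hi, hfg' i hi, hgf' i hi] using this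
    have ih' := ih K' hS (hf.mono (by simp)) (hg.mono (by simp))
      (fun i hi l hl => hfg i (mem_insert_of_mem hi) l (mem_insert_of_mem hl))
    have hfilter_f : ∀ T : Finset α, {i ∈ S | f i ∈ insert (f j) T ∧ g i ∈ insert (f j) T} =
        {i ∈ S | f i ∈ T ∧ g i ∈ T} := fun T =>
      filter_congr fun i hi => by simp [hf' i hi, hgf' i hi]
    have hfilter_g : ∀ T : Finset α, {i ∈ S | f i ∈ insert (g j) T ∧ g i ∈ insert (g j) T} =
        {i ∈ S | f i ∈ T ∧ g i ∈ T} := fun T =>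
      filter_congr fun i hi => by simp [hg' i hi, hfg' i hi]
    rw [sum_powerset_insert hfK', sum_powerset_insert hgK', sum_powerset_insert hgK',
      card_insert_of_notMem hfK', card_insert_of_notMem hgK', card_insert_of_notMem hj,
      ← sum_add_distrib, ← sum_add_distrib, ← sum_add_distrib]
    trans ∑ H ∈ K'.powerset, (3 + x) * x ^ #{i ∈ S | f i ∈ H ∧ g i ∈ H}
    · refine sum_congr rfl fun H hH => ?_
      have hfH : f j ∉ H := fun h => hfK' (mem_insert_of_mem (mem_powerset.1 hH h))
      have hgH : g j ∉ H := fun h => hgK' (mem_powerset.1 hH h)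
      have hjS : j ∉ {i ∈ S | f i ∈ H ∧ g i ∈ H} := fun h => hj (mem_filter.1 h).1
      simp only [filter_insert, hfilter_f, hfilter_g]
      simp only [mem_insert, hfH, hgH, hne, hne.symm, or_false,
        or_true, and_false, and_true, if_false, if_true, card_insert_of_notMem hjS]
      ring
    · rw [← mul_sum, ih']
      ring

theorem card_filter_pair_deviation_le {ι α : Type*} [DecidableEq ι] [DecidableEq α]
    (f g : ι → α) (S : Finset ι) (K : Finset α) (hK : ∀ j ∈ S, f j ∈ K ∧ g j ∈ K)
    (hf : Set.InjOn f S) (hg : Set.InjOn g S) (hfg : ∀ i ∈ S, ∀ j ∈ S, f i ≠ g j)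
    {τ C : ℝ} (hτ0 : 0 ≤ τ) (hτ1 : τ ≤ 1) (hC : (#S : ℝ) ≤ C) :
    (#{H ∈ K.powerset | τ * C < |(#{j ∈ S | f j ∈ H ∧ g j ∈ H} : ℝ) - #S / 4|} : ℝ) ≤
      2 * (2 ^ #K * Real.exp (-(τ ^ 2 / 2 * C))) := by
  have hC0 : 0 ≤ C := (Nat.cast_nonneg _).trans hC
  have hmgf : ∀ t : ℝ, |t| = τ →
      ∑ H ∈ K.powerset, Real.exp (t * ((#{j ∈ S | f j ∈ H ∧ g j ∈ H} : ℝ) - #S / 4)) ≤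
        2 ^ #K * Real.exp (τ ^ 2 / 4 * C) := by
    intro t ht
    have h1 : ∀ H : Finset α, Real.exp (t * ((#{j ∈ S | f j ∈ H ∧ g j ∈ H} : ℝ) - #S / 4)) =
        Real.exp (-(t * (#S / 4))) * Real.exp t ^ #{j ∈ S | f j ∈ H ∧ g j ∈ H} := by
      intro H
      rw [← Real.exp_nat_mul, ← Real.exp_add]
      ring_nf
    simp_rw [h1]
    rw [← mul_sum, sum_powerset_pow_card_filter_pair f g _ S K hK hf hg hfg]
    have h2 : (3 + Real.exp t) / 4 ≤ Real.exp (t / 4 + τ ^ 2 / 4) := by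
      have := (abs_le.1 (Real.abs_exp_sub_one_sub_id_le (x := t) (by linarith))).2
      have h3 := Real.add_one_le_exp (t / 4 + τ ^ 2 / 4)
      rw [← sq_abs t, ht] at this
      linarith
    have h4 : ((3 + Real.exp t) / 4) ^ #S ≤ Real.exp (t * (#S / 4)) * Real.exp (τ ^ 2 / 4 * C) := by
      refine (pow_le_pow_left₀ (by positivity) h2 _).trans ?_
      rw [← Real.exp_nat_mul, ← Real.exp_add]
      refine Real.exp_le_exp.2 ?_
      nlinarith [sq_nonneg τ]
    calc _ ≤ Real.exp (-(t * (#S / 4))) * (2 ^ #K *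
          (Real.exp (t * (#S / 4)) * Real.exp (τ ^ 2 / 4 * C))) := by gcongr
      _ = Real.exp (-(t * (#S / 4))) * Real.exp (t * (#S / 4)) *
          (2 ^ #K * Real.exp (τ ^ 2 / 4 * C)) := by ring
      _ = _ := by rw [← Real.exp_add]; simp
  have hsum := add_le_add (hmgf τ (abs_of_nonneg hτ0)) (hmgf (-τ) (by simp [abs_of_nonneg hτ0]))
  rw [← sum_add_distrib] at hsum
  have hmarkov : (#{H ∈ K.powerset |
      τ * C < |(#{j ∈ S | f j ∈ H ∧ g j ∈ H} : ℝ) - #S / 4|} : ℝ) * Real.exp (τ * (τ * C)) ≤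
      2 ^ #K * Real.exp (τ ^ 2 / 4 * C) + 2 ^ #K * Real.exp (τ ^ 2 / 4 * C) := by
    refine le_trans ?_ hsum
    rw [← nsmul_eq_mul, ← sum_const]
    refine (sum_le_sum fun H hH => ?_).trans
      (sum_le_sum_of_subset_of_nonneg (filter_subset _ _) fun _ _ _ => by positivity)
    have hH' := (mem_filter.1 hH).2
    rcases lt_abs.1 hH' with h | h
    · refine (Real.exp_le_exp.2 (mul_le_mul_of_nonneg_left h.le hτ0)).trans ?_
      exact le_add_of_nonneg_right (Real.exp_pos _).le
    · refine (Real.exp_le_exp.2 (mul_le_mul_of_nonneg_left h.le hτ0)).trans ?_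
      rw [mul_neg, ← neg_mul]
      exact le_add_of_nonneg_left (Real.exp_pos _).le
  have hexp : Real.exp (τ ^ 2 / 4 * C) ≤ Real.exp (-(τ ^ 2 / 2 * C)) * Real.exp (τ * (τ * C)) := by
    rw [← Real.exp_add]
    refine Real.exp_le_exp.2 ?_
    nlinarith [mul_nonneg (sq_nonneg τ) hC0]
  refine le_of_mul_le_mul_right (hmarkov.trans ?_) (Real.exp_pos (τ * (τ * C)))
  have := mul_le_mul_of_nonneg_left hexp (show (0 : ℝ) ≤ 2 ^ #K by positivity)
  linarith

theorem tendsto_choose_div_choose {β : Type*} {l : Filter β} {N Z : β → ℕ} {a : ℝ} (ha : 0 < a)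
    (r : ℕ) (hN : Filter.Tendsto N l Filter.atTop)
    (hZ : Filter.Tendsto (fun b => (Z b : ℝ) / N b) l (nhds a)) :
    Filter.Tendsto (fun b => ((Z b).choose r : ℝ) / (N b).choose r) l (nhds (a ^ r)) := by
  have hNR : Filter.Tendsto (fun b => (N b : ℝ)) l Filter.atTop :=
    tendsto_natCast_atTop_atTop.comp hN
  have hZN : Filter.Tendsto Z l Filter.atTop := by
    refine tendsto_natCast_atTop_iff.1 ((hZ.pos_mul_atTop ha hNR).congr' ?_)
    filter_upwards [hNR.eventually_gt_atTop 0] with b hb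
    field_simp
  have key := ((isEquivalent_choose r).comp_tendsto hZN).div
    ((isEquivalent_choose r).comp_tendsto hN)
  refine key.symm.tendsto_nhds ((hZ.pow r).congr fun b => ?_)
  simp only [Function.comp, Pi.div_apply]
  rw [div_div_div_cancel_right₀ (by positivity), div_pow]

theorem exists_abs_choose_sub_le {a : ℝ} (ha : 0 < a) (r : ℕ) {ε : ℝ} (hε : 0 < ε) :
    ∃ δ > 0, ∃ N : ℕ, ∀ n ≥ N, ∀ z : ℕ, |(z : ℝ) - a * n| ≤ δ * n →
      |(z.choose r : ℝ) - a ^ r * n.choose r| ≤ ε * n.choose r := by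
  let l : Filter (ℕ × ℕ) :=
    Filter.comap (fun p => (p.1, (p.2 : ℝ) / p.1)) (Filter.atTop ×ˢ nhds a)
  have hl : Filter.Tendsto (fun p : ℕ × ℕ => (p.1, (p.2 : ℝ) / p.1)) l
    (Filter.atTop ×ˢ nhds a) := Filter.tendsto_comap
  have h1 : Filter.Tendsto (fun p : ℕ × ℕ => p.1) l Filter.atTop := hl.fst
  have h2 : Filter.Tendsto (fun p : ℕ × ℕ => (p.2 : ℝ) / p.1) l (nhds a) :=
    hl.snd
  have h3 := (tendsto_choose_div_choose ha r h1 h2).eventually (Metric.closedBall_mem_nhds _ hε)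
  obtain ⟨s, hs, hs'⟩ := Filter.mem_comap.1 h3
  obtain ⟨⟨N, δ⟩, ⟨-, hδ⟩, hsub⟩ :=
    (Filter.atTop_basis.prod Metric.nhds_basis_closedBall).mem_iff.1 hs
  refine ⟨δ, hδ, max N (max r 1), fun n hn z hz => ?_⟩
  have hn1 : N ≤ n := (le_max_left _ _).trans hn
  have hn2 : r ≤ n := (le_max_left _ _).trans ((le_max_right _ _).trans hn)
  have hn3 : 0 < n := (le_max_right _ _).trans ((le_max_right _ _).trans hn)
  have hn4 : (0 : ℝ) < n := Nat.cast_pos.2 hn3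
  have hc : (0 : ℝ) < n.choose r := Nat.cast_pos.2 (Nat.choose_pos hn2)
  have hmem : ((n, z) : ℕ × ℕ) ∈ (fun p : ℕ × ℕ => (p.1, (p.2 : ℝ) / p.1)) ⁻¹' s := by
    refine hsub ⟨hn1, ?_⟩
    rw [Metric.mem_closedBall, Real.dist_eq]
    have : (z : ℝ) / n - a = (z - a * n) / n := by field_simp
    rw [this, abs_div, abs_of_pos hn4, div_le_iff₀ hn4]
    exact hz
  have h5 := hs' hmem
  simp only [Set.mem_ofPred_eq, Real.dist_eq] at h5
  have : (z.choose r : ℝ) - a ^ r * n.choose r = (z.choose r / n.choose r - a ^ r) * n.choose r := by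
    field_simp
  rw [this, abs_mul, abs_of_pos hc]
  gcongr

/-- The `(k-1)`-sets `J ⊆ [n] \ {u, v}` for which `{u} ∪ J` and `{v} ∪ J` both lie in `K`. -/
def jointLink (n k : ℕ) (K : Finset (Finset (Fin n))) (u v : Fin n) : Finset (Finset (Fin n)) :=
  {J ∈ (univ \ {u, v}).powersetCard (k - 1) | insert u J ∈ K ∧ insert v J ∈ K}

theorem mem_jointLink {n k : ℕ} {K : Finset (Finset (Fin n))} {u v : Fin n}
    {J : Finset (Fin n)} (hJ : J ∈ jointLink n k K u v) :
    (insert u J ∈ K ∧ insert v J ∈ K) ∧ u ∉ J ∧ v ∉ J := by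
  obtain ⟨h1, h2⟩ := mem_filter.1 hJ
  have h3 := (mem_powersetCard.1 h1).1
  exact ⟨h2, fun h => by simpa using h3 h, fun h => by simpa using h3 h⟩

theorem jointDeg_eq_card_filter_jointLink {n k : ℕ} {H K : Finset (Finset (Fin n))} (hHK : H ⊆ K)
    (u v : Fin n) :
    jointDeg n k H u v = #{J ∈ jointLink n k K u v | insert u J ∈ H ∧ insert v J ∈ H} := by
  rw [jointDeg, jointLink, filter_filter]
  congr 1
  exact filter_congr fun J _ => ⟨fun h => ⟨⟨hHK h.1, hHK h.2⟩, h⟩, fun h => h.2⟩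

theorem card_jointDeg_deviation_le {n : ℕ} (k : ℕ) (K : Finset (Finset (Fin n))) {u v : Fin n}
    (huv : u ≠ v) {τ : ℝ} (hτ0 : 0 ≤ τ) (hτ1 : τ ≤ 1) :
    (#{H ∈ K.powerset | τ * n.choose (k - 1) <
      |(jointDeg n k H u v : ℝ) - #(jointLink n k K u v) / 4|} : ℝ) ≤
      2 * (2 ^ #K * Real.exp (-(τ ^ 2 / 2 * n.choose (k - 1)))) := by
  have hcard : #(jointLink n k K u v) ≤ n.choose (k - 1) := by
    refine (card_filter_le _ _).trans ?_
    rw [card_powersetCard]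
    exact Nat.choose_le_choose _ ((card_le_univ _).trans_eq (Fintype.card_fin n))
  have hinj : ∀ w : Fin n, (∀ J ∈ jointLink n k K u v, w ∉ J) →
      Set.InjOn (fun J => insert w J) (jointLink n k K u v : Set (Finset (Fin n))) := by
    intro w hw I hI J hJ h
    rw [← erase_insert (hw I hI), ← erase_insert (hw J hJ)]
    exact congrArg (fun s => s.erase w) h
  have key := card_filter_pair_deviation_le (fun J => insert u J) (fun J => insert v J)
    (jointLink n k K u v) K (fun J hJ => (mem_jointLink hJ).1)
    (hinj u fun J hJ => (mem_jointLink hJ).2.1) (hinj v fun J hJ => (mem_jointLink hJ).2.2)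
    (fun I _ J hJ h => by
      have hu : u ∈ insert v J := h ▸ mem_insert_self u I
      simp [huv, (mem_jointLink hJ).2.1] at hu)
    hτ0 hτ1 (C := n.choose (k - 1)) (Nat.cast_le.2 hcard)
  convert key using 5 with H hH
  rw [jointDeg_eq_card_filter_jointLink (mem_powerset.1 hH)]

theorem crossing_comm (n k : ℕ) (X Y : Finset (Fin n)) : crossing n k X Y = crossing n k Y X := by
  simp only [crossing, and_comm]

theorem filter_subset_powersetCard {n : ℕ} (r : ℕ) (A B : Finset (Fin n)) :
    {J ∈ (univ \ B).powersetCard r | J ⊆ A} = (A \ B).powersetCard r := by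
  ext J
  simp only [mem_filter, mem_powersetCard, subset_sdiff, subset_univ, true_and]
  tauto

theorem insert_mem_crossing {n k : ℕ} (hk : 1 ≤ k) {X Y : Finset (Fin n)} (hXY : Disjoint X Y)
    {u : Fin n} (hu : u ∈ X) {J : Finset (Fin n)} (huJ : u ∉ J) (hJ : #J = k - 1) :
    insert u J ∈ crossing n k X Y ↔ ¬ J ⊆ X := by
  have huY : u ∉ Y := disjoint_left.1 hXY hu
  simp [crossing, mem_powersetCard, insert_subset_iff, hu, huY, card_insert_of_notMem huJ, hJ,
    Nat.sub_add_cancel hk]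

theorem card_jointLink_same {n k : ℕ} (hk : 1 ≤ k) {X Y : Finset (Fin n)} (hXY : Disjoint X Y)
    {u v : Fin n} (hu : u ∈ X) (hv : v ∈ X) :
    #(jointLink n k (crossing n k X Y) u v) + (#(X \ {u, v})).choose (k - 1) =
      (#(univ \ {u, v})).choose (k - 1) := by
  have h : jointLink n k (crossing n k X Y) u v =
      {J ∈ (univ \ {u, v}).powersetCard (k - 1) | ¬ J ⊆ X} := by
    refine filter_congr fun J hJ => ?_
    simp only [mem_powersetCard, subset_sdiff, disjoint_insert_right, disjoint_singleton_right] at hJ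
    rw [insert_mem_crossing hk hXY hu hJ.1.2.1 hJ.2, insert_mem_crossing hk hXY hv hJ.1.2.2 hJ.2,
      and_self]
  rw [h, ← card_powersetCard, ← card_powersetCard, ← filter_subset_powersetCard _ X, add_comm,
    card_filter_add_card_filter_not]

theorem card_jointLink_opposite {n k : ℕ} (hk : 2 ≤ k) {X Y : Finset (Fin n)} (hXY : Disjoint X Y)
    {u v : Fin n} (hu : u ∈ X) (hv : v ∈ Y) :
    #(jointLink n k (crossing n k X Y) u v) +
      ((#(X \ {u, v})).choose (k - 1) + (#(Y \ {u, v})).choose (k - 1)) =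
      (#(univ \ {u, v})).choose (k - 1) := by
  have h : jointLink n k (crossing n k X Y) u v =
      {J ∈ (univ \ {u, v}).powersetCard (k - 1) | ¬ (J ⊆ X ∨ J ⊆ Y)} := by
    refine filter_congr fun J hJ => ?_
    simp only [mem_powersetCard, subset_sdiff, disjoint_insert_right, disjoint_singleton_right] at hJ
    rw [insert_mem_crossing (by omega) hXY hu hJ.1.2.1 hJ.2, crossing_comm,
      insert_mem_crossing (by omega) hXY.symm hv hJ.1.2.2 hJ.2, not_or]
  have hdisj : Disjoint {J ∈ (univ \ {u, v}).powersetCard (k - 1) | J ⊆ X}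
      {J ∈ (univ \ {u, v}).powersetCard (k - 1) | J ⊆ Y} := by
    rw [disjoint_filter]
    intro J hJ hJX hJY
    have hJ0 : J = ∅ := by simpa using hXY hJX hJY
    have := (mem_powersetCard.1 hJ).2
    rw [hJ0, card_empty] at this
    omega
  rw [h, ← card_powersetCard, ← card_powersetCard, ← card_powersetCard,
    ← filter_subset_powersetCard _ X, ← filter_subset_powersetCard _ Y, ← card_union_of_disjoint hdisj,
    ← filter_or, add_comm, card_filter_add_card_filter_not]

theorem abs_card_sdiff_pair_sub_le {n : ℕ} {δ : ℝ} (hn : 2 ≤ δ / 2 * n) {X Y : Finset (Fin n)}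
    (hXY : Disjoint X Y) (hU : X ∪ Y = univ) (hX : (1 - δ) * n / 2 ≤ (#X : ℝ))
    (hY : (1 - δ) * n / 2 ≤ (#Y : ℝ)) (u v : Fin n) :
    |(#(X \ {u, v}) : ℝ) - 1 / 2 * n| ≤ δ * n := by
  have h1 : (#X : ℝ) + #Y = n := by
    rw [← Nat.cast_add, ← card_union_of_disjoint hXY, hU, card_univ, Fintype.card_fin]
  have h2 : (#(X \ {u, v}) : ℝ) ≤ #X := by exact_mod_cast card_le_card sdiff_subset
  have h3 : (#X : ℝ) ≤ #(X \ {u, v}) + 2 := by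
    have h4 := card_le_card_sdiff_add_card (s := X) (t := {u, v})
    have h5 := card_le_two (a := u) (b := v)
    exact_mod_cast h4.trans (Nat.add_le_add_left h5 _)
  rw [abs_le]
  constructor <;> linarith

theorem abs_card_univ_sdiff_pair_sub_le {n : ℕ} {δ : ℝ} (hn : 2 ≤ δ / 2 * n) (u v : Fin n) :
    |(#(univ \ {u, v} : Finset (Fin n)) : ℝ) - 1 * n| ≤ δ * n := by
  have h2 : (#(univ \ {u, v} : Finset (Fin n)) : ℝ) ≤ n := by
    exact_mod_cast (card_le_univ _).trans_eq (Fintype.card_fin n)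
  have h3 : (n : ℝ) ≤ #(univ \ {u, v} : Finset (Fin n)) + 2 := by
    have h4 := card_le_card_sdiff_add_card (s := (univ : Finset (Fin n))) (t := {u, v})
    rw [card_univ, Fintype.card_fin] at h4
    have h5 := card_le_two (a := u) (b := v)
    exact_mod_cast h4.trans (Nat.add_le_add_left h5 _)
  rw [abs_le]
  constructor <;> linarith

theorem exists_abs_card_jointLink_sub_le {k : ℕ} (hk : 2 ≤ k) {ε : ℝ} (hε : 0 < ε) :
    ∃ γ : ℝ, 0 < γ ∧ γ < 1 ∧ ∃ N : ℕ, ∀ n : ℕ, N ≤ n → ∀ X Y : Finset (Fin n), Disjoint X Y →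
      X ∪ Y = univ → (1 - γ) * n / 2 ≤ (#X : ℝ) → (1 - γ) * n / 2 ≤ (#Y : ℝ) → ∀ u v : Fin n,
      ((u ∈ X ∧ v ∈ X) ∨ (u ∈ Y ∧ v ∈ Y) →
        |(#(jointLink n k (crossing n k X Y) u v) : ℝ) -
          n.choose (k - 1) * (1 - (1 / 2) ^ (k - 1))| ≤ ε * n.choose (k - 1)) ∧
      (¬ ((u ∈ X ∧ v ∈ X) ∨ (u ∈ Y ∧ v ∈ Y)) →
        |(#(jointLink n k (crossing n k X Y) u v) : ℝ) -
          n.choose (k - 1) * (1 - 2 * (1 / 2) ^ (k - 1))| ≤ ε * n.choose (k - 1)) := by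
  obtain ⟨δ₁, hδ₁, N₁, h₁⟩ :=
    exists_abs_choose_sub_le one_pos (k - 1) (ε := ε / 3) (by positivity)
  obtain ⟨δ₂, hδ₂, N₂, h₂⟩ :=
    exists_abs_choose_sub_le (a := 1 / 2) (by norm_num) (k - 1) (ε := ε / 3) (by positivity)
  obtain ⟨γ, hγ0, hγ⟩ : ∃ γ : ℝ, 0 < γ ∧ γ < min (min δ₁ δ₂) 1 :=
    exists_between (by positivity)
  obtain ⟨N₃, hN₃⟩ := exists_nat_ge (4 / γ)
  have hγ₁ : γ ≤ δ₁ := hγ.le.trans ((min_le_left _ _).trans (min_le_left _ _))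
  have hγ₂ : γ ≤ δ₂ := hγ.le.trans ((min_le_left _ _).trans (min_le_right _ _))
  refine ⟨γ, hγ0, hγ.trans_le (min_le_right _ _), max N₁ (max N₂ N₃), ?_⟩
  intro n hn X Y hXY hU hX hY u v
  have hn₁ : N₁ ≤ n := (le_max_left _ _).trans hn
  have hn₂ : N₂ ≤ n := (le_max_left _ _).trans ((le_max_right _ _).trans hn)
  have hn₃ : (N₃ : ℝ) ≤ n := Nat.cast_le.2 ((le_max_right _ _).trans ((le_max_right _ _).trans hn))
  have hn2 : 2 ≤ γ / 2 * n := by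
    have := (div_le_iff₀ hγ0).1 (hN₃.trans hn₃)
    linarith
  have hU' := h₁ n hn₁ _ ((abs_card_univ_sdiff_pair_sub_le hn2 u v).trans (by gcongr))
  have hX' := h₂ n hn₂ _ ((abs_card_sdiff_pair_sub_le hn2 hXY hU hX hY u v).trans (by gcongr))
  have hY' := h₂ n hn₂ _ ((abs_card_sdiff_pair_sub_le hn2 hXY.symm (union_comm X Y ▸ hU)
    hY hX u v).trans (by gcongr))
  rw [one_pow, one_mul, abs_le] at hU'
  rw [abs_le] at hX' hY'
  have hC : 0 ≤ ε * (n.choose (k - 1) : ℝ) := by positivity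
  constructor
  · rintro (⟨hu, hv⟩ | ⟨hu, hv⟩)
    · have := congrArg (Nat.cast (R := ℝ)) (card_jointLink_same (k := k) (by omega) hXY hu hv)
      push_cast at this
      rw [abs_le]
      constructor <;> linarith
    · have := congrArg (Nat.cast (R := ℝ)) (card_jointLink_same (k := k) (by omega) hXY.symm hu hv)
      push_cast at this
      rw [crossing_comm, abs_le]
      constructor <;> linarith
  · intro h
    have hmem : ∀ w : Fin n, w ∈ X ∨ w ∈ Y := fun w => mem_union.1 (hU ▸ mem_univ w)
    have : (u ∈ X ∧ v ∈ Y) ∨ (u ∈ Y ∧ v ∈ X) := by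
      have := hmem u
      have := hmem v
      tauto
    rcases this with ⟨hu, hv⟩ | ⟨hu, hv⟩
    · have := congrArg (Nat.cast (R := ℝ)) (card_jointLink_opposite hk hXY hu hv)
      push_cast at this
      rw [abs_le]
      constructor <;> linarith
    · have := congrArg (Nat.cast (R := ℝ)) (card_jointLink_opposite hk hXY.symm hu hv)
      push_cast at this
      rw [crossing_comm, abs_le]
      constructor <;> linarith

theorem exists_sigmaStandardWrt_of_jointDeg_near {k : ℕ} (hk : 2 ≤ k) {σ : ℝ} (hσ : 0 < σ) :
    ∃ γ : ℝ, 0 < γ ∧ γ < 1 ∧ ∃ N : ℕ, ∀ n : ℕ, N ≤ n → ∀ X Y : Finset (Fin n), Disjoint X Y →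
      X ∪ Y = univ → (1 - γ) * n / 2 ≤ (#X : ℝ) → (1 - γ) * n / 2 ≤ (#Y : ℝ) →
      ∀ H : Finset (Finset (Fin n)), (∀ u v : Fin n, u ≠ v →
        |(jointDeg n k H u v : ℝ) - #(jointLink n k (crossing n k X Y) u v) / 4| ≤
          σ / 8 * n.choose (k - 1)) → SigmaStandardWrt n k σ H X Y := by
  obtain ⟨γ, hγ0, hγ1, N, h⟩ := exists_abs_card_jointLink_sub_le hk (half_pos hσ)
  refine ⟨γ, hγ0, hγ1, N, fun n hn X Y hXY hU hX hY H hH u v huv => ?_⟩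
  obtain ⟨hsame, hopp⟩ := h n hn X Y hXY hU hX hY u v
  have hd := abs_le.1 (hH u v huv)
  have e1 : (2 : ℝ) ^ (1 - (k : ℤ)) = (1 / 2) ^ (k - 1) := by
    rw [one_div, inv_pow, ← zpow_natCast, ← zpow_neg, Nat.cast_sub (by omega)]
    congr 1
    push_cast
    ring
  have e2 : (2 : ℝ) ^ (2 - (k : ℤ)) = 2 * (1 / 2) ^ (k - 1) := by
    rw [← e1, ← zpow_one_add₀ two_ne_zero]
    congr 1
    ring
  rw [e1, e2]
  constructor
  · intro hs
    have := abs_le.1 (hsame hs)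
    rw [abs_le]
    constructor <;> linarith
  · intro hs
    have := abs_le.1 (hopp hs)
    rw [abs_le]
    constructor <;> linarith

theorem pow_div_le_choose {n r : ℕ} (h : 2 * r ≤ n) :
    (n : ℝ) ^ r / (2 ^ r * r.factorial) ≤ n.choose r := by
  refine le_trans ?_ (Nat.pow_le_choose r n)
  rw [← div_div, ← div_pow]
  gcongr
  rw [div_le_iff₀ two_pos]
  exact_mod_cast (by omega : n ≤ (n + 1 - r) * 2)

theorem exists_two_mul_sq_le_exp {b : ℝ} (hb : 0 < b) {r : ℕ} (hr : r ≠ 0) :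
    ∃ N : ℕ, ∀ n : ℕ, N ≤ n → 2 * (n : ℝ) ^ 2 ≤ Real.exp (b * (n : ℝ) ^ r) := by
  have h1 := ((isLittleO_pow_exp_pos_mul_atTop 2 hb).bound (half_pos one_pos)).natCast_atTop
  obtain ⟨N, hN⟩ := Filter.eventually_atTop.1 h1
  refine ⟨max N 1, fun n hn => ?_⟩
  have h2 := hN n ((le_max_left _ _).trans hn)
  rw [Real.norm_of_nonneg (by positivity), Real.norm_of_nonneg (by positivity)] at h2
  have h3 : (1 : ℝ) ≤ n := Nat.one_le_cast.2 ((le_max_right _ _).trans hn)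
  have h4 : Real.exp (b * n) ≤ Real.exp (b * (n : ℝ) ^ r) := by
    gcongr
    exact le_self_pow₀ h3 hr
  linarith

theorem stmt6 (k : ℕ) (hk : 3 ≤ k) (σ : ℝ) (hσ0 : 0 < σ) (hσ1 : σ < (2 : ℝ) ^ (-(k : ℤ))) :
    ∃ γ : ℝ, 0 < γ ∧ γ < 1 ∧ ∃ c : ℝ, 0 < c ∧ ∃ N : ℕ, ∀ n : ℕ, N ≤ n →
      ∀ X Y : Finset (Fin n), Disjoint X Y → X ∪ Y = Finset.univ →
        (1 - γ) * n / 2 ≤ (X.card : ℝ) → (1 - γ) * n / 2 ≤ (Y.card : ℝ) →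
        (({H : Finset (Finset (Fin n)) | H ⊆ crossing n k X Y ∧
            ¬ SigmaStandardWrt n k σ H X Y}.ncard : ℝ))
          ≤ (2 : ℝ) ^ ((crossing n k X Y).card) * (2 : ℝ) ^ (-(c * (n : ℝ) ^ (k - 1))) := by
  obtain ⟨γ, hγ0, hγ1, N₁, hstd⟩ := exists_sigmaStandardWrt_of_jointDeg_near
    (show 2 ≤ k by omega) hσ0
  have hσ : σ ≤ 1 := hσ1.le.trans (zpow_le_one_of_nonpos₀ one_le_two (by simp))
  set b : ℝ := (σ / 8) ^ 2 / 2 / (2 ^ (k - 1) * (k - 1).factorial) with hb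
  have hb0 : 0 < b := by positivity
  obtain ⟨N₂, hN₂⟩ := exists_two_mul_sq_le_exp (half_pos hb0) (show k - 1 ≠ 0 by omega)
  have hlog : 0 < Real.log 2 := Real.log_pos one_lt_two
  refine ⟨γ, hγ0, hγ1, b / 2 / Real.log 2, by positivity, max N₁ (max N₂ (2 * k)), ?_⟩
  intro n hn X Y hXY hU hX hY
  have hn₁ : N₁ ≤ n := (le_max_left _ _).trans hn
  have hn₂ : N₂ ≤ n := (le_max_left _ _).trans ((le_max_right _ _).trans hn)
  have hn₃ : 2 * k ≤ n := (le_max_right _ _).trans ((le_max_right _ _).trans hn)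
  set K := crossing n k X Y
  have hexp : (2 : ℝ) ^ (-(b / 2 / Real.log 2 * (n : ℝ) ^ (k - 1))) =
      Real.exp (-(b / 2 * (n : ℝ) ^ (k - 1))) := by
    rw [Real.rpow_def_of_pos two_pos]
    congr 1
    field_simp
  let bad : Fin n × Fin n → Finset (Finset (Finset (Fin n))) := fun p =>
    {H ∈ K.powerset | σ / 8 * n.choose (k - 1) <
      |(jointDeg n k H p.1 p.2 : ℝ) - #(jointLink n k K p.1 p.2) / 4|}
  let P : Finset (Fin n × Fin n) := {p | p.1 ≠ p.2}
  have hsub : {H : Finset (Finset (Fin n)) | H ⊆ K ∧ ¬ SigmaStandardWrt n k σ H X Y} ⊆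
      (P.biUnion bad : Set (Finset (Finset (Fin n)))) := by
    rintro H ⟨hHK, hH⟩
    by_contra hnot
    refine hH (hstd n hn₁ X Y hXY hU hX hY H fun u v huv => ?_)
    by_contra! hlt
    exact hnot (mem_coe.2 (mem_biUnion.2 ⟨(u, v), by simp [P, huv],
      mem_filter.2 ⟨mem_powerset.2 hHK, hlt⟩⟩))
  have hncard : ({H : Finset (Finset (Fin n)) | H ⊆ K ∧ ¬ SigmaStandardWrt n k σ H X Y}.ncard : ℝ)
      ≤ ∑ p ∈ P, (#(bad p) : ℝ) := by
    have := Set.ncard_le_ncard hsub (finite_toSet _)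
    rw [Set.ncard_coe_finset] at this
    exact_mod_cast this.trans card_biUnion_le
  have hP : (#P : ℝ) ≤ (n : ℝ) ^ 2 := by
    have := card_le_univ P
    rw [Fintype.card_prod, Fintype.card_fin, ← sq] at this
    exact_mod_cast this
  have hbad : ∀ p ∈ P, (#(bad p) : ℝ) ≤ 2 * (2 ^ #K * Real.exp (-(b * (n : ℝ) ^ (k - 1)))) := by
    intro p hp
    refine (card_jointDeg_deviation_le k K (mem_filter.1 hp).2 (by positivity)
      (by linarith)).trans ?_
    refine mul_le_mul_of_nonneg_left (mul_le_mul_of_nonneg_left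
      (Real.exp_le_exp.2 (neg_le_neg ?_)) (by positivity)) zero_le_two
    have := pow_div_le_choose (n := n) (r := k - 1) (by omega)
    calc b * (n : ℝ) ^ (k - 1)
        = (σ / 8) ^ 2 / 2 * ((n : ℝ) ^ (k - 1) / (2 ^ (k - 1) * (k - 1).factorial)) := by
          rw [hb]; ring
      _ ≤ _ := by gcongr
  rw [hexp]
  calc _ ≤ ∑ p ∈ P, (#(bad p) : ℝ) := hncard
    _ ≤ #P * (2 * (2 ^ #K * Real.exp (-(b * (n : ℝ) ^ (k - 1))))) := by
      rw [← nsmul_eq_mul]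
      exact sum_le_card_nsmul _ _ _ hbad
    _ ≤ (n : ℝ) ^ 2 * (2 * (2 ^ #K * Real.exp (-(b * (n : ℝ) ^ (k - 1))))) := by gcongr
    _ = 2 ^ #K * (2 * (n : ℝ) ^ 2 * Real.exp (-(b * (n : ℝ) ^ (k - 1)))) := by ring
    _ ≤ 2 ^ #K * (Real.exp (b / 2 * (n : ℝ) ^ (k - 1)) *
          Real.exp (-(b * (n : ℝ) ^ (k - 1)))) := by
      gcongr
      exact hN₂ n hn₂
    _ = _ := by
      rw [← Real.exp_add]
      congr 2
      ring
end

section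
/- Fix an integer k ≥ 3 and a real δ ∈ (0,1). There exist c > 0 and N such that for every n ≥ N and every partition [n] = X ∪ Y, the number of k-graphs H on [n] with E_H ⊆ K[X,Y] for which there exist pairwise disjoint sets J, X₀, Y₀ with J a (k−2)-element subset of [n], X₀ ⊆ X, Y₀ ⊆ Y, |X₀| > δn, |Y₀| > δn, and |e_{H_J}(X₀,Y₀) − (1/2)·|X₀|·|Y₀|| > δ·(1/2)·|X₀|·|Y₀|, is at most 2^{|K[X,Y]|} · 2^{−c·n²}. -/
open Finset

/-- The exponential moment of the deviation of `|H ∩ E|` over all `H ⊆ C`. -/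
lemma sum_powerset_exp_inter {α : Type*} [DecidableEq α] {C E : Finset α} (hE : E ⊆ C) (t : ℝ) :
    ∑ H ∈ C.powerset, Real.exp (t * (2 * ((H ∩ E).card : ℝ) - E.card)) =
      2 ^ C.card * Real.cosh t ^ E.card := by
  have key := Finset.prod_add (fun e => if e ∈ E then Real.exp t else 1)
    (fun e => if e ∈ E then Real.exp (-t) else 1) C
  have hL : ∏ e ∈ C, ((if e ∈ E then Real.exp t else 1) + (if e ∈ E then Real.exp (-t) else 1)) =
      2 ^ C.card * Real.cosh t ^ E.card := by
    have h : ∀ e ∈ C, ((if e ∈ E then Real.exp t else 1) + (if e ∈ E then Real.exp (-t) else 1)) =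
        2 * (if e ∈ E then Real.cosh t else 1) := by
      intro e _
      split_ifs
      · rw [Real.cosh_eq]; ring
      · norm_num
    rw [Finset.prod_congr rfl h, Finset.prod_mul_distrib, Finset.prod_const,
      Finset.prod_ite_mem, Finset.prod_const, Finset.inter_eq_right.mpr hE]
  rw [← hL, key]
  refine Finset.sum_congr rfl fun H hH => ?_
  have hHC := Finset.mem_powerset.mp hH
  have hcard : ((C \ H) ∩ E).card + (H ∩ E).card = E.card := by
    have h1 : (C \ H) ∩ E = E \ H := by
      grind
    rw [h1, Finset.inter_comm H E, Finset.card_sdiff_add_card_inter]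
  rw [Finset.prod_ite_mem, Finset.prod_ite_mem, Finset.prod_const, Finset.prod_const,
    ← Real.exp_nat_mul, ← Real.exp_nat_mul, ← Real.exp_add, ← hcard]
  push_cast
  ring_nf

/-- One-sided Chernoff bound for the uniform random subset of `C`; a negative `t` bounds the
lower tail. -/
lemma card_filter_powerset_tail_le {α : Type*} [DecidableEq α] {C E : Finset α} (hE : E ⊆ C)
    (t : ℝ) :
    ((C.powerset.filter fun H =>
        t ^ 2 * E.card ≤ t * (2 * ((H ∩ E).card : ℝ) - E.card)).card : ℝ) ≤
      2 ^ C.card * Real.exp (-(t ^ 2 * E.card / 2)) := by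
  set F := C.powerset.filter fun H =>
    t ^ 2 * (E.card : ℝ) ≤ t * (2 * ((H ∩ E).card : ℝ) - E.card)
  have h1 : (F.card : ℝ) * Real.exp (t ^ 2 * E.card) ≤
      2 ^ C.card * Real.exp (t ^ 2 * E.card / 2) := by
    calc (F.card : ℝ) * Real.exp (t ^ 2 * E.card)
        = ∑ _H ∈ F, Real.exp (t ^ 2 * E.card) := by rw [Finset.sum_const, nsmul_eq_mul]
      _ ≤ ∑ H ∈ F, Real.exp (t * (2 * ((H ∩ E).card : ℝ) - E.card)) :=
          Finset.sum_le_sum fun H hH => Real.exp_le_exp.mpr (Finset.mem_filter.mp hH).2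
      _ ≤ ∑ H ∈ C.powerset, Real.exp (t * (2 * ((H ∩ E).card : ℝ) - E.card)) :=
          Finset.sum_le_sum_of_subset_of_nonneg (Finset.filter_subset _ _)
            fun _ _ _ => (Real.exp_pos _).le
      _ = 2 ^ C.card * Real.cosh t ^ E.card := sum_powerset_exp_inter hE t
      _ ≤ 2 ^ C.card * Real.exp (t ^ 2 / 2) ^ E.card := by
          gcongr
          exact Real.cosh_le_exp_half_sq t
      _ = 2 ^ C.card * Real.exp (t ^ 2 * E.card / 2) := by
          rw [← Real.exp_nat_mul]; ring_nf
  rw [← le_div_iff₀ (Real.exp_pos _), mul_div_assoc, ← Real.exp_sub] at h1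
  rwa [show t ^ 2 * (E.card : ℝ) / 2 - t ^ 2 * E.card = -(t ^ 2 * E.card / 2) by ring] at h1

/-- Chernoff bound for the uniform random subset of `C`. -/
lemma card_filter_powerset_deviation_le {α : Type*} [DecidableEq α] {C E : Finset α} (hE : E ⊆ C)
    {δ : ℝ} (hδ : 0 < δ) :
    ((C.powerset.filter fun H =>
        δ * (1 / 2 * (E.card : ℝ)) < |((H ∩ E).card : ℝ) - 1 / 2 * E.card|).card : ℝ) ≤
      2 * (2 ^ C.card * Real.exp (-(δ ^ 2 * E.card / 2))) := by
  have hpos := card_filter_powerset_tail_le hE δ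
  have hneg := card_filter_powerset_tail_le hE (-δ)
  rw [neg_sq] at hneg
  rw [two_mul]
  refine le_trans ?_ (add_le_add hpos hneg)
  rw [← Nat.cast_add, Nat.cast_le]
  refine le_trans (Finset.card_le_card fun H hH => ?_) (Finset.card_union_le _ _)
  rw [Finset.mem_filter] at hH
  rw [Finset.mem_union, Finset.mem_filter, Finset.mem_filter]
  rcases lt_abs.mp hH.2 with h | h
  · left
    exact ⟨hH.1, by nlinarith⟩
  · right
    exact ⟨hH.1, by nlinarith⟩

/-- The sets `J ∪ {a, b}` with `a ∈ A` and `b ∈ B`. -/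
def linkSets (n : ℕ) (J A B : Finset (Fin n)) : Finset (Finset (Fin n)) :=
  (A ×ˢ B).image fun p => insert p.1 (insert p.2 J)

lemma injOn_insert_insert {n : ℕ} {J A B : Finset (Fin n)} (hJA : Disjoint J A)
    (hJB : Disjoint J B) (hAB : Disjoint A B) :
    Set.InjOn (fun p : Fin n × Fin n => insert p.1 (insert p.2 J)) (A ×ˢ B : Finset _) := by
  rintro ⟨a, b⟩ hp ⟨a', b'⟩ hq h
  simp only [Finset.coe_product, Set.mem_prod, Finset.mem_coe] at hp hq
  rw [Finset.disjoint_left] at hJA hJB hAB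
  have ha : a ∈ insert a' (insert b' J) := by
    rw [← show insert a (insert b J) = insert a' (insert b' J) from h]; simp
  have hb : b ∈ insert a' (insert b' J) := by
    rw [← show insert a (insert b J) = insert a' (insert b' J) from h]; simp
  simp only [Finset.mem_insert] at ha hb
  grind

lemma card_linkSets {n : ℕ} {J A B : Finset (Fin n)} (hJA : Disjoint J A)
    (hJB : Disjoint J B) (hAB : Disjoint A B) :
    (linkSets n J A B).card = A.card * B.card := by
  rw [linkSets, Finset.card_image_of_injOn (injOn_insert_insert hJA hJB hAB),
    Finset.card_product]

lemma linkBetween_eq_card_inter {n : ℕ} (H : Finset (Finset (Fin n))) {J A B : Finset (Fin n)}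
    (hJA : Disjoint J A) (hJB : Disjoint J B) (hAB : Disjoint A B) :
    linkBetween n H J A B = (H ∩ linkSets n J A B).card := by
  have hinj := injOn_insert_insert hJA hJB hAB
  rw [linkBetween, ← Finset.card_image_of_injOn
    (hinj.mono (Finset.coe_subset.mpr (Finset.filter_subset _ _)))]
  congr 1
  ext e
  rw [Finset.disjoint_right] at hJA hJB
  simp only [linkSets, Finset.mem_image, Finset.mem_filter, Finset.mem_inter, Finset.mem_product]
  constructor
  · rintro ⟨p, ⟨hp, -, -, hH⟩, rfl⟩
    exact ⟨hH, p, hp, rfl⟩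
  · rintro ⟨hH, p, hp, rfl⟩
    exact ⟨p, ⟨hp, hJA hp.1, hJB hp.2, hH⟩, rfl⟩

lemma linkSets_subset_crossing {n k : ℕ} (hk : 2 ≤ k) {X Y J A B : Finset (Fin n)}
    (hXY : Disjoint X Y) (hJ : J.card = k - 2) (hA : A ⊆ X) (hB : B ⊆ Y)
    (hJA : Disjoint J A) (hJB : Disjoint J B) :
    linkSets n J A B ⊆ crossing n k X Y := by
  intro e he
  simp only [linkSets, Finset.mem_image, Finset.mem_product] at he
  obtain ⟨⟨a, b⟩, ⟨ha, hb⟩, rfl⟩ := he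
  have hbJ : b ∉ J := Finset.disjoint_right.mp hJB hb
  have hab : a ≠ b := Finset.disjoint_iff_ne.mp hXY a (hA ha) b (hB hb)
  have haJ : a ∉ insert b J := by
    simp [hab, Finset.disjoint_right.mp hJA ha]
  simp only [crossing, Finset.mem_filter, Finset.mem_powersetCard, Finset.subset_univ, true_and]
  refine ⟨?_, fun h => ?_, fun h => ?_⟩
  · rw [Finset.card_insert_of_notMem haJ, Finset.card_insert_of_notMem hbJ, hJ]; omega
  · exact Finset.disjoint_left.mp hXY (h (by simp)) (hB hb)
  · exact Finset.disjoint_left.mp hXY (hA ha) (h (by simp))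

theorem stmt10 (k : ℕ) (hk : 3 ≤ k) (δ : ℝ) (hδ0 : 0 < δ) (hδ1 : δ < 1) :
    ∃ c : ℝ, 0 < c ∧ ∃ N : ℕ, ∀ n : ℕ, N ≤ n →
      ∀ X Y : Finset (Fin n), Disjoint X Y → X ∪ Y = Finset.univ →
        (({H : Finset (Finset (Fin n)) | H ⊆ crossing n k X Y ∧
            ∃ J X₀ Y₀ : Finset (Fin n), J.card = k - 2 ∧ X₀ ⊆ X ∧ Y₀ ⊆ Y ∧
              Disjoint J X₀ ∧ Disjoint J Y₀ ∧ Disjoint X₀ Y₀ ∧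
              δ * n < (X₀.card : ℝ) ∧ δ * n < (Y₀.card : ℝ) ∧
              δ * ((1 / 2 : ℝ) * (X₀.card : ℝ) * (Y₀.card : ℝ)) <
                |(linkBetween n H J X₀ Y₀ : ℝ) -
                  (1 / 2 : ℝ) * (X₀.card : ℝ) * (Y₀.card : ℝ)|}.ncard : ℝ))
          ≤ (2 : ℝ) ^ ((crossing n k X Y).card) * (2 : ℝ) ^ (-(c * (n : ℝ) ^ 2)) := by
  refine ⟨δ ^ 4 / 4, by positivity, ⌈16 / δ ^ 4⌉₊ + 1, fun n hn X Y hXY _ => ?_⟩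
  set C := crossing n k X Y
  let T : Finset (Finset (Fin n) × Finset (Fin n) × Finset (Fin n)) :=
    Finset.univ.filter fun p => p.1.card = k - 2 ∧ p.2.1 ⊆ X ∧ p.2.2 ⊆ Y ∧
      Disjoint p.1 p.2.1 ∧ Disjoint p.1 p.2.2 ∧ Disjoint p.2.1 p.2.2 ∧
      δ * n < (p.2.1.card : ℝ) ∧ δ * n < (p.2.2.card : ℝ)
  let F : Finset (Fin n) × Finset (Fin n) × Finset (Fin n) → Finset (Finset (Finset (Fin n))) :=
    fun p => C.powerset.filter fun H =>
      δ * (1 / 2 * ((linkSets n p.1 p.2.1 p.2.2).card : ℝ)) <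
        |((H ∩ linkSets n p.1 p.2.1 p.2.2).card : ℝ) -
          1 / 2 * (linkSets n p.1 p.2.1 p.2.2).card|
  have hF : ∀ p ∈ T, ((F p).card : ℝ) ≤ 2 * (2 ^ C.card * (2 : ℝ) ^ (-(δ ^ 4 * n ^ 2 / 2))) := by
    rintro ⟨J, A, B⟩ hp
    obtain ⟨hJ, hA, hB, hJA, hJB, hAB, hcA, hcB⟩ := (Finset.mem_filter.mp hp).2
    refine (card_filter_powerset_deviation_le
      (linkSets_subset_crossing (by omega) hXY hJ hA hB hJA hJB) hδ0).trans ?_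
    rw [card_linkSets hJA hJB hAB, Nat.cast_mul, Real.rpow_def_of_pos two_pos]
    have hAB' : (δ * n) * (δ * n) ≤ (A.card : ℝ) * B.card := by gcongr
    have hexp : δ ^ 4 * n ^ 2 ≤ δ ^ 2 * ((A.card : ℝ) * B.card) := by
      nlinarith [mul_le_mul_of_nonneg_left hAB' (sq_nonneg δ)]
    have hlog : Real.log 2 ≤ 1 := by linarith [Real.log_two_lt_d9]
    have hnn : 0 ≤ δ ^ 4 * (n : ℝ) ^ 2 := by positivity
    gcongr
    nlinarith
  have hsub : {H : Finset (Finset (Fin n)) | H ⊆ crossing n k X Y ∧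
      ∃ J X₀ Y₀ : Finset (Fin n), J.card = k - 2 ∧ X₀ ⊆ X ∧ Y₀ ⊆ Y ∧
        Disjoint J X₀ ∧ Disjoint J Y₀ ∧ Disjoint X₀ Y₀ ∧
        δ * n < (X₀.card : ℝ) ∧ δ * n < (Y₀.card : ℝ) ∧
        δ * ((1 / 2 : ℝ) * (X₀.card : ℝ) * (Y₀.card : ℝ)) <
          |(linkBetween n H J X₀ Y₀ : ℝ) - (1 / 2 : ℝ) * (X₀.card : ℝ) * (Y₀.card : ℝ)|} ⊆
      (T.biUnion F : Finset _) := by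
    rintro H ⟨hHC, J, A, B, hJ, hA, hB, hJA, hJB, hAB, hcA, hcB, hdev⟩
    rw [Finset.mem_coe, Finset.mem_biUnion]
    refine ⟨(J, A, B), Finset.mem_filter.mpr
      ⟨Finset.mem_univ _, hJ, hA, hB, hJA, hJB, hAB, hcA, hcB⟩,
      Finset.mem_filter.mpr ⟨Finset.mem_powerset.mpr hHC, ?_⟩⟩
    rw [linkBetween_eq_card_inter H hJA hJB hAB] at hdev
    simpa only [card_linkSets hJA hJB hAB, Nat.cast_mul, mul_assoc] using hdev
  have hT : (T.card : ℝ) ≤ (2 : ℝ) ^ (3 * (n : ℝ)) := by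
    have h : T.card ≤ 2 ^ (3 * n) := by
      refine (Finset.card_le_univ T).trans (le_of_eq ?_)
      simp only [Fintype.card_prod, Fintype.card_finset, Fintype.card_fin]
      ring
    have h' : (T.card : ℝ) ≤ (2 : ℝ) ^ (3 * n) := by exact_mod_cast h
    rwa [← Real.rpow_natCast, Nat.cast_mul, Nat.cast_ofNat] at h'
  have hlarge : 3 * (n : ℝ) + 1 ≤ δ ^ 4 * n ^ 2 / 4 := by
    have h1 : 16 / δ ^ 4 + 1 ≤ (n : ℝ) := by
      have : ((⌈16 / δ ^ 4⌉₊ + 1 : ℕ) : ℝ) ≤ n := Nat.cast_le.mpr hn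
      push_cast at this
      linarith [Nat.le_ceil (16 / δ ^ 4)]
    have h2 : 16 ≤ (n : ℝ) * δ ^ 4 := (div_le_iff₀ (by positivity)).mp (by linarith)
    have h3 : 0 < 16 / δ ^ 4 := by positivity
    nlinarith
  calc _ ≤ ((T.biUnion F).card : ℝ) := by
        rw [← Set.ncard_coe_finset, Nat.cast_le]
        exact Set.ncard_le_ncard hsub (Finset.finite_toSet _)
    _ ≤ ∑ p ∈ T, ((F p).card : ℝ) := by exact_mod_cast Finset.card_biUnion_le
    _ ≤ T.card * (2 * (2 ^ C.card * (2 : ℝ) ^ (-(δ ^ 4 * n ^ 2 / 2)))) := by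
        rw [← nsmul_eq_mul]
        exact Finset.sum_le_card_nsmul _ _ _ hF
    _ ≤ (2 : ℝ) ^ (3 * (n : ℝ)) * (2 * (2 ^ C.card * (2 : ℝ) ^ (-(δ ^ 4 * n ^ 2 / 2)))) := by
        gcongr
    _ = 2 ^ C.card * (2 : ℝ) ^ (3 * (n : ℝ) + 1 + -(δ ^ 4 * n ^ 2 / 2)) := by
        rw [Real.rpow_add two_pos, Real.rpow_add two_pos, Real.rpow_one]
        ring
    _ ≤ 2 ^ C.card * (2 : ℝ) ^ (-(δ ^ 4 / 4 * (n : ℝ) ^ 2)) := by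
        gcongr
        · norm_num
        · linarith
end
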